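/- arXiv:2312.09931 — 2 statements merged into one kernel-verified Lean document; each statement's English description precedes it below -/
import Mathlib

section
/- Let {p_j} be a sequence of monic real polynomials with deg p_j = j, orthogonal on (a,b) with respect to the weight w(x) > 0, let k ∈ {0,1,2}, let c_{2k} be a real polynomial of degree 2k with c_{2k}(x)w(x) > 0 on (a,b), and let {g_{j,k}} be monic real polynomials with deg g_{j,k} = j, orthogonal on (a,b) with respect to c_{2k}(x)w(x). Fix n ≥ 2 and suppose A_n·c_{2k}(x)·g_{n−2,k}(x) = a_{2k−2}(x)·p_n(x) − (x − B_n)·p_{n−1}(x) holds on (a,b) with A_n, B_n real constants and a_{2k−2} a real polynomial of degree 2k−2 (a constant when k = 0). Assume p_n has n simple real zeros x_1 < x_2 < ⋯ < x_n in (a,b), that g_{n−2,k} has n−2 simple real zeros in (a,b), and that g_{n−2,k} and p_n have no common zero. Then the polynomial (x − B_n)·g_{n−2,k}(x) has n−1 real simple zeros t_1 < t_2 < ⋯ < t_{n−1} which interlace with the zeros of p_n, i.e. x_i < t_i < x_{i+1} for each i ∈ {1,…,n−1}; in particular x_1 < B_n < x_n, so B_n is an upper bound for the smallest zero and a lower bound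 for the largest zero of p_n. -/
open MeasureTheory Polynomial

theorem integrableOn_eval_mul {S : Set ℝ} {w : ℝ → ℝ}
    (hmom : ∀ j : ℕ, IntegrableOn (fun x => x ^ j * w x) S) (f : ℝ[X]) :
    IntegrableOn (fun x => f.eval x * w x) S := by
  induction f using Polynomial.induction_on' with
  | add f g hf hg =>
    simp only [eval_add, add_mul]
    exact Integrable.add hf hg
  | monomial j r =>
    simp only [eval_monomial, mul_assoc]
    exact Integrable.const_mul (hmom j) r

/-- The moment functional `f ↦ ∫ f w` of a weight with finite moments. -/
noncomputable def momentFunctional (S : Set ℝ) (w : ℝ → ℝ)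
    (hmom : ∀ j : ℕ, IntegrableOn (fun x => x ^ j * w x) S) : ℝ[X] →ₗ[ℝ] ℝ where
  toFun f := ∫ x in S, f.eval x * w x
  map_add' f g := by
    simp only [eval_add, add_mul]
    exact integral_add (integrableOn_eval_mul hmom f) (integrableOn_eval_mul hmom g)
  map_smul' r f := by
    simp only [eval_smul, smul_eq_mul, mul_assoc, RingHom.id_apply]
    exact integral_const_mul _ _

theorem momentFunctional_mul_self_pos {S : Set ℝ} {w : ℝ → ℝ} (hSo : IsOpen S) (hSn : S.Nonempty)
    (hw : ∀ x ∈ S, 0 < w x)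
    (hmom : ∀ j : ℕ, IntegrableOn (fun x => x ^ j * w x) S) {f : ℝ[X]} (hf : f ≠ 0) :
    0 < momentFunctional S w hmom (f * f) := by
  have hnn : 0 ≤ᵐ[volume.restrict S] fun x => (f * f).eval x * w x := by
    filter_upwards [ae_restrict_mem hSo.measurableSet] with x hx
    rw [eval_mul]
    exact mul_nonneg (mul_self_nonneg _) (hw x hx).le
  refine (setIntegral_pos_iff_support_of_nonneg_ae hnn
    (integrableOn_eval_mul hmom (f * f))).2 ?_
  have hsub : S \ {x | f.IsRoot x} ⊆ (Function.support fun x => (f * f).eval x * w x) ∩ S := by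
    rintro x ⟨hx, hfx⟩
    exact ⟨by simpa [eval_mul, (hw x hx).ne'] using hfx, hx⟩
  refine lt_of_lt_of_le ?_ (measure_mono hsub)
  rw [measure_sdiff_null ((finite_setOfPred_isRoot hf).measure_zero _)]
  exact hSo.measure_pos _ hSn

section OrthogonalFunctional

variable {L : ℝ[X] →ₗ[ℝ] ℝ} {p : ℕ → ℝ[X]}

theorem orthogonal_of_degree_lt (hmonic : ∀ j, (p j).Monic) (hdeg : ∀ j, (p j).natDegree = j)
    (horth : ∀ i j, i ≠ j → L (p i * p j) = 0) {m : ℕ} :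
    ∀ s : ℝ[X], s.degree < m → L (p m * s) = 0 := by
  suffices h : ∀ d ≤ m, ∀ s : ℝ[X], s.degree < d → L (p m * s) = 0 from h m le_rfl
  intro d
  induction d with
  | zero =>
    intro _ s hs
    have : s = 0 := by simpa using hs
    simp [this]
  | succ d ih =>
    intro hd s hs
    have hpd : (p d).degree = d := by rw [degree_eq_natDegree (hmonic d).ne_zero, hdeg]
    have hlow : (s - C (s.coeff d) * p d).degree < d := by
      rw [degree_lt_iff_coeff_zero] at hs ⊢
      intro j hj
      rcases hj.eq_or_lt with rfl | hj
      · have : (p d).coeff d = 1 := by simpa only [hdeg] using (hmonic d).coeff_natDegree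
        simp [this]
      · have : (p d).coeff j = 0 := coeff_eq_zero_of_natDegree_lt (by rwa [hdeg])
        simp [this, hs j hj]
    have h := ih (by omega) _ hlow
    have hmul : p m * (s - C (s.coeff d) * p d) = p m * s - s.coeff d • (p m * p d) := by
      rw [smul_eq_C_mul]; ring
    rw [hmul, map_sub, map_smul, horth m d (by omega)] at h
    simpa using h

/-- `p_n` and the derivative of `p_{n+1}` have the same sign at a simple zero of `p_{n+1}`. -/
theorem eval_mul_eval_pos_of_orthogonal (hpos : ∀ f : ℝ[X], f ≠ 0 → 0 < L (f * f))
    (hmonic : ∀ j, (p j).Monic) (hdeg : ∀ j, (p j).natDegree = j)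
    (horth : ∀ i j, i ≠ j → L (p i * p j) = 0) {n : ℕ} {h : ℝ[X]} {z : ℝ}
    (hfac : p (n + 1) = (X - C z) * h) (hz : h.eval z ≠ 0) :
    0 < (p n).eval z * h.eval z := by
  have hhm : h.Monic := (monic_X_sub_C z).of_mul_monic_left (hfac ▸ hmonic (n + 1))
  have hhdeg : h.natDegree = n := by
    have := hdeg (n + 1)
    rw [hfac, (monic_X_sub_C z).natDegree_mul hhm, natDegree_X_sub_C] at this
    omega
  have hpn : (p n).degree = n := by rw [degree_eq_natDegree (hmonic n).ne_zero, hdeg]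
  have hhn : h.degree = n := by rw [degree_eq_natDegree hhm.ne_zero, hhdeg]
  have hα : L (p n * h) = L (p n * p n) := by
    have h0 := orthogonal_of_degree_lt hmonic hdeg horth (h - p n) (m := n) (by
      rw [← hhn]
      exact degree_sub_lt_left (by rw [hhn, hpn]) hhm.ne_zero
        (by rw [hhm.leadingCoeff, (hmonic n).leadingCoeff]))
    rw [mul_sub, map_sub] at h0
    linarith
  obtain ⟨s, hs⟩ : X - C z ∣ h.eval z • p n - (p n).eval z • h := by
    rw [dvd_iff_isRoot]
    simp [mul_comm]
  have hsdeg : s.degree < (n + 1 : ℕ) := by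
    by_cases hs0 : s = 0
    · simp [hs0]
    have hle : (h.eval z • p n - (p n).eval z • h).natDegree ≤ n :=
      (natDegree_sub_le _ _).trans
        (max_le ((natDegree_smul_le _ _).trans (hdeg n).le) ((natDegree_smul_le _ _).trans hhdeg.le))
    rw [hs, (monic_X_sub_C z).natDegree_mul' hs0, natDegree_X_sub_C] at hle
    rw [degree_eq_natDegree hs0]
    exact_mod_cast (by omega : s.natDegree < n + 1)
  have hkey : h.eval z * L (p n * p n) = (p n).eval z * L (h * h) := by
    have h0 := orthogonal_of_degree_lt hmonic hdeg horth s hsdeg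
    have : p (n + 1) * s = h.eval z • (p n * h) - (p n).eval z • (h * h) := by
      rw [hfac, mul_right_comm, ← hs, sub_mul, smul_mul_assoc, smul_mul_assoc]
    rw [this, map_sub, map_smul, map_smul, hα] at h0
    simpa [sub_eq_zero] using h0
  have h1 := hpos _ (hmonic n).ne_zero
  have h2 := hpos _ hhm.ne_zero
  have h3 : 0 < (p n).eval z * h.eval z * L (h * h) := by
    have : (p n).eval z * h.eval z * L (h * h) = h.eval z ^ 2 * L (p n * p n) := by
      linear_combination -h.eval z * hkey
    rw [this]
    positivity
  exact pos_of_mul_pos_left h3 h2.le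

end OrthogonalFunctional

theorem eq_prod_X_sub_C_of_injective {f : ℝ[X]} {n : ℕ} (hf : f.Monic) (hd : f.natDegree = n)
    {x : Fin n → ℝ} (hx : Function.Injective x) (hz : ∀ i, f.eval (x i) = 0) :
    f = ∏ i, (X - C (x i)) := by
  refine eq_of_monic_of_dvd_of_natDegree_le (monic_prod_X_sub_C _ _) hf ?_ ?_
  · exact Finset.prod_dvd_of_coprime (fun i _ j _ hij => pairwise_coprime_X_sub_C hx hij)
      fun i _ => dvd_iff_isRoot.2 (hz i)
  · rw [hd, natDegree_finsetProd_X_sub_C_eq_card]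
    simp

/-- The derivative of a real-rooted polynomial with simple zeros changes sign between consecutive
zeros. -/
theorem prod_erase_mul_prod_erase_neg {n : ℕ} {x : Fin n → ℝ} (hx : StrictMono x) {i j : Fin n}
    (hij : i.1 + 1 = j.1) :
    (∏ l ∈ Finset.univ.erase i, (x i - x l)) * ∏ l ∈ Finset.univ.erase j, (x j - x l) < 0 := by
  have hlt : i < j := Fin.lt_def.2 (by omega)
  rw [← Finset.mul_prod_erase (Finset.univ.erase i) _
      (Finset.mem_erase.2 ⟨hlt.ne', Finset.mem_univ j⟩),
    ← Finset.mul_prod_erase (Finset.univ.erase j) _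
      (Finset.mem_erase.2 ⟨hlt.ne, Finset.mem_univ i⟩),
    Finset.erase_right_comm, mul_mul_mul_comm, ← Finset.prod_mul_distrib]
  have hxij := hx hlt
  refine mul_neg_of_neg_of_pos
    (mul_neg_of_neg_of_pos (by linarith) (by linarith)) (Finset.prod_pos fun l hl => ?_)
  simp only [Finset.mem_erase, Finset.mem_univ, and_true] at hl
  rcases lt_or_gt_of_ne hl.1 with h | h
  · exact mul_pos (sub_pos.2 (hx h)) (sub_pos.2 (hx (h.trans hlt)))
  · have hjl : j < l := by
      have := Fin.val_ne_of_ne hl.2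
      rw [Fin.lt_def] at h ⊢
      omega
    exact mul_pos_of_neg_of_neg (sub_neg.2 (hx h)) (sub_neg.2 (hx hjl))

theorem exists_isRoot_Ioo_of_mul_neg (f : ℝ[X]) {u v : ℝ} (huv : u < v)
    (h : f.eval u * f.eval v < 0) : ∃ t ∈ Set.Ioo u v, f.eval t = 0 := by
  rcases mul_neg_iff.1 h with ⟨h1, h2⟩ | ⟨h1, h2⟩
  · exact intermediate_value_Ioo' huv.le f.continuous.continuousOn ⟨h2, h1⟩
  · exact intermediate_value_Ioo huv.le f.continuous.continuousOn ⟨h1, h2⟩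

/-- **Corollary 2.2 (ii) (co-prime case).** Under the connection formula
`A_n·c(x)·g_{n−2}(x) = a_{2k−2}(x)·p_n(x) − (x − B_n)·p_{n−1}(x)` with `k ∈ {0,1,2}`,
if `p_n` has `n` simple real zeros `x_1 < ⋯ < x_n` in `(a,b)`, `g_{n−2}` has `n−2`
simple real zeros in `(a,b)`, and `g_{n−2}` and `p_n` are co-prime, then the `n−1`
zeros of `(x−B_n)·g_{n−2}(x)` are real and simple and interlace with the zeros of
`p_n`; in particular `x_1 < B_n < x_n`. -/
theorem interlacing_coprime_case
    (a b : EReal) (hab : a < b)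
    (S : Set ℝ) (hS : S = {x : ℝ | a < (x : EReal) ∧ (x : EReal) < b})
    (w : ℝ → ℝ) (hw : ∀ x ∈ S, 0 < w x)
    (hmom : ∀ j : ℕ, IntegrableOn (fun x => x ^ j * w x) S)
    (p : ℕ → Polynomial ℝ)
    (hpmonic : ∀ j, (p j).Monic) (hpdeg : ∀ j, (p j).natDegree = j)
    (hporth : ∀ i j, i ≠ j → ∫ x in S, (p i).eval x * (p j).eval x * w x = 0)
    (k : ℕ) (hk : k ≤ 2)
    (c : Polynomial ℝ) (hcdeg : c.degree = ((2 * k : ℕ) : WithBot ℕ))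
    (hcw : ∀ x ∈ S, 0 < c.eval x * w x)
    (hcwmom : ∀ j : ℕ, IntegrableOn (fun x => x ^ j * (c.eval x * w x)) S)
    (g : ℕ → Polynomial ℝ)
    (hgmonic : ∀ j, (g j).Monic) (hgdeg : ∀ j, (g j).natDegree = j)
    (hgorth : ∀ i j, i ≠ j →
      ∫ x in S, (g i).eval x * (g j).eval x * (c.eval x * w x) = 0)
    (n : ℕ) (hn : 2 ≤ n)
    (A B : ℝ) (q : Polynomial ℝ)
    (hq0 : k = 0 → q.natDegree = 0)
    (hq1 : 1 ≤ k → q.degree = ((2 * k - 2 : ℕ) : WithBot ℕ))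
    (hrec : ∀ x ∈ S, A * c.eval x * (g (n - 2)).eval x =
      q.eval x * (p n).eval x - (x - B) * (p (n - 1)).eval x)
    (x : Fin n → ℝ) (hxmono : StrictMono x) (hxS : ∀ i, x i ∈ S)
    (hxz : ∀ i, (p n).eval (x i) = 0)
    (y : Fin (n - 2) → ℝ) (hymono : StrictMono y) (hyS : ∀ i, y i ∈ S)
    (hyz : ∀ i, (g (n - 2)).eval (y i) = 0)
    (hcoprime : ∀ z : ℝ, (p n).eval z = 0 → (g (n - 2)).eval z ≠ 0) :
    ∃ t : Fin (n - 1) → ℝ, StrictMono t ∧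
      (∀ i, ((X - C B) * g (n - 2)).eval (t i) = 0) ∧
      (∀ i : Fin (n - 1),
        x ⟨i.1, by have := i.isLt; omega⟩ < t i ∧
        t i < x ⟨i.1 + 1, by have := i.isLt; omega⟩) ∧
      x ⟨0, by omega⟩ < B ∧ B < x ⟨n - 1, by omega⟩ := by
  obtain ⟨m, rfl⟩ : ∃ m, n = m + 2 := ⟨n - 2, by omega⟩
  simp only [Nat.add_sub_cancel, show m + 2 - 1 = m + 1 by omega] at *
  have hSo : IsOpen S := by
    rw [hS]
    exact (isOpen_Ioo (a := a) (b := b)).preimage continuous_coe_real_ereal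
  have hfac : ∀ i, p (m + 2) = (X - C (x i)) * ∏ l ∈ Finset.univ.erase i, (X - C (x l)) := by
    intro i
    rw [Finset.mul_prod_erase _ (fun l => X - C (x l)) (Finset.mem_univ i)]
    exact eq_prod_X_sub_C_of_injective (hpmonic _) (hpdeg _) hxmono.injective hxz
  have hsign : ∀ i, 0 < (p (m + 1)).eval (x i) * ∏ l ∈ Finset.univ.erase i, (x i - x l) := by
    intro i
    have hne : ∏ l ∈ Finset.univ.erase i, (x i - x l) ≠ 0 :=
      Finset.prod_ne_zero_iff.2 fun l hl =>
        sub_ne_zero.2 (hxmono.injective.ne (Finset.ne_of_mem_erase hl).symm)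
    have := eval_mul_eval_pos_of_orthogonal (L := momentFunctional S w hmom)
      (fun f hf => momentFunctional_mul_self_pos hSo ⟨x i, hxS i⟩ hw hmom hf)
      hpmonic hpdeg (fun i j hij => by
        simpa only [momentFunctional, LinearMap.coe_mk, AddHom.coe_mk, eval_mul]
          using hporth i j hij) (hfac i) (by simpa [eval_prod] using hne)
    simpa [eval_prod] using this
  have hpne : ∀ i, (p (m + 1)).eval (x i) ≠ 0 := fun i h => by simpa [h] using hsign i
  have hcpos : ∀ i, 0 < c.eval (x i) := fun i =>
    pos_of_mul_pos_left (hcw _ (hxS i)) (hw _ (hxS i)).le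
  have hval : ∀ i, A * c.eval (x i) * (g m).eval (x i) = -((x i - B) * (p (m + 1)).eval (x i)) := by
    intro i
    rw [hrec _ (hxS i), hxz i]
    ring
  have hA : A ≠ 0 := by
    rintro rfl
    have hB : ∀ i, x i = B := fun i => by
      simpa [hpne i, sub_eq_zero] using hval i
    have := hxmono (show (⟨0, by omega⟩ : Fin (m + 2)) < ⟨1, by omega⟩ by simp)
    rw [hB, hB] at this
    exact lt_irrefl _ this
  have hxB : ∀ i, x i - B ≠ 0 := by
    intro i h
    have := hval i
    rw [h] at this
    simp [hA, (hcpos i).ne', hcoprime _ (hxz i)] at this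
  have hneg : ∀ i j : Fin (m + 2), i.1 + 1 = j.1 →
      ((X - C B) * g m).eval (x i) * ((X - C B) * g m).eval (x j) < 0 := by
    intro i j hij
    have hP : (p (m + 1)).eval (x i) * (p (m + 1)).eval (x j) < 0 := by
      have h1 := mul_pos (hsign i) (hsign j)
      rw [mul_mul_mul_comm] at h1
      exact neg_of_mul_pos_left h1 (prod_erase_mul_prod_erase_neg hxmono hij).le
    have hG : A ^ 2 * (c.eval (x i) * c.eval (x j)) *
        (((X - C B) * g m).eval (x i) * ((X - C B) * g m).eval (x j)) =
        (x i - B) ^ 2 * (x j - B) ^ 2 *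
          ((p (m + 1)).eval (x i) * (p (m + 1)).eval (x j)) := by
      simp only [eval_mul, eval_sub, eval_X, eval_C]
      linear_combination (A * c.eval (x j) * (g m).eval (x j) * (x i - B) * (x j - B)) * hval i -
        ((x i - B) ^ 2 * (x j - B) * (p (m + 1)).eval (x i)) * hval j
    have hi := hcpos i
    have hj := hcpos j
    have hBi := hxB i
    have hBj := hxB j
    refine neg_of_mul_neg_right (hG.trans_lt (mul_neg_of_pos_of_neg (by positivity) hP)) ?_
    positivity
  have hex : ∀ i : Fin (m + 1), ∃ t ∈ Set.Ioo (x i.castSucc) (x i.succ),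
      ((X - C B) * g m).eval t = 0 := fun i =>
    exists_isRoot_Ioo_of_mul_neg _ (hxmono i.castSucc_lt_succ) (hneg _ _ (by simp))
  choose t ht hroot using hex
  have htmono : StrictMono t := fun i j hij =>
    (ht i).2.trans_le ((hxmono.monotone (Fin.succ_le_castSucc_iff.2 hij)).trans (ht j).1.le)
  obtain ⟨i, hi⟩ : ∃ i, t i = B := by
    by_contra! hne
    have hgroot : ∀ i, (g m).eval (t i) = 0 := fun i => by
      simpa [sub_eq_zero, hne i] using hroot i
    refine (hgmonic m).ne_zero (eq_zero_of_natDegree_lt_card_of_eval_eq_zero _ htmono.injective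
      hgroot ?_)
    simp [hgdeg]
  refine ⟨t, htmono, hroot, fun i => ht i, ?_, ?_⟩
  · rw [← hi]
    exact (hxmono.monotone (Fin.le_def.2 (Nat.zero_le _))).trans_lt (ht i).1
  · rw [← hi]
    exact (ht i).2.trans_le (hxmono.monotone (Fin.le_def.2 (by have := i.isLt; simp; omega)))
end

section
/- For every λ > 0, every φ with 0 < φ < π, every integer n ≥ 2 and every x ∈ ℂ, the monic Meixner–Pollaczek polynomials satisfy [2(n−1) sin²φ / ((2λ+1)(2λ+n−1)(λ+n))] · (λ² + x²)((λ+1)² + x²) · P_{n−2}^{(λ+2)}(x;φ) = (x + λ(λ+1)·cos φ/((λ+n) sin φ)) · P_{n−1}^{(λ)}(x;φ) − D(x) · P_n^{(λ)}(x;φ), where D(x) = [λ(λ+1)(4λ − (n−1)cos 2φ + n + 1)]/((2λ+1)(2λ+n−1)(λ+n)) + [2(n−1)((λ + 1/2) sin 2φ − x sin²φ)]·x/((2λ+1)(2λ+n−1)(λ+n)). -/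
open scoped BigOperators

/-- Pochhammer symbol `(α)_j = α(α+1)⋯(α+j−1)` in a commutative semiring. -/
noncomputable def poch {R : Type*} [CommSemiring R] (α : R) (j : ℕ) : R :=
  ∏ i ∈ Finset.range j, (α + i)

/-- The monic Meixner–Pollaczek polynomial
`P_n^{(λ)}(x;φ) = iⁿ (2λ)_n (e^{2iφ}/(e^{2iφ}−1))ⁿ ·
  Σ_{j=0}^{n} [(−n)_j (λ+ix)_j / ((2λ)_j · j!)] (1 − e^{−2iφ})^j`. -/
noncomputable def meixnerPollaczek (lam phi : ℝ) (n : ℕ) (x : ℂ) : ℂ :=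
  Complex.I ^ n * poch (2 * (lam : ℂ)) n *
    (Complex.exp (2 * Complex.I * phi) / (Complex.exp (2 * Complex.I * phi) - 1)) ^ n *
    ∑ j ∈ Finset.range (n + 1),
      poch (-(n : ℂ)) j * poch ((lam : ℂ) + Complex.I * x) j /
          (poch (2 * (lam : ℂ)) j * (j.factorial : ℂ)) *
        (1 - Complex.exp (-(2 * Complex.I * phi))) ^ j

theorem poch_succ {R : Type*} [CommSemiring R] (α : R) (j : ℕ) :
    poch α (j + 1) = poch α j * (α + j) := by
  simp [poch, Finset.prod_range_succ]

theorem poch_succ_left {R : Type*} [CommSemiring R] (α : R) (j : ℕ) :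
    poch α (j + 1) = α * poch (α + 1) j := by
  simp only [poch, Finset.prod_range_succ', Nat.cast_zero, add_zero, Nat.cast_add, Nat.cast_one]
  rw [mul_comm]
  congr 1
  exact Finset.prod_congr rfl fun i _ => by ring

theorem poch_neg_natCast_eq_zero {R : Type*} [CommRing R] {n j : ℕ} (h : n < j) :
    poch (-(n : R)) j = 0 :=
  Finset.prod_eq_zero (Finset.mem_range.2 h) (by simp)

/-- The `j`-th term of the Gauss hypergeometric series `₂F₁(b, a; c; z)`. -/
noncomputable def gaussTerm (b a c z : ℂ) (j : ℕ) : ℂ :=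
  poch b j * poch a j / (poch c j * (j.factorial : ℂ)) * z ^ j

/-- The terminating Gauss hypergeometric series `₂F₁(-n, a; c; z)`. -/
noncomputable def gaussPoly (n : ℕ) (a c z : ℂ) : ℂ :=
  ∑ j ∈ Finset.range (n + 1), gaussTerm (-(n : ℂ)) a c z j

theorem gaussPoly_eq_sum_range {n N : ℕ} (h : n + 1 ≤ N) (a c z : ℂ) :
    gaussPoly n a c z = ∑ j ∈ Finset.range N, gaussTerm (-(n : ℂ)) a c z j := by
  refine Finset.sum_subset (Finset.range_subset_range.2 h) fun j _ hj => ?_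
  rw [Finset.mem_range, not_lt] at hj
  rw [gaussTerm, poch_neg_natCast_eq_zero hj]
  simp

theorem sum_range_add_two_gaussTerm (N : ℕ) (b a c z : ℂ) :
    ∑ j ∈ Finset.range (N + 2), gaussTerm b a c z j =
      ∑ j ∈ Finset.range N, gaussTerm b a c z (j + 2) + b * a / c * z + 1 := by
  rw [Finset.sum_range_succ', Finset.sum_range_succ']
  simp [gaussTerm, poch]

theorem sum_range_add_one_gaussTerm (N : ℕ) (b a c z : ℂ) :
    ∑ j ∈ Finset.range (N + 1), gaussTerm b a c z j =
      ∑ j ∈ Finset.range N, gaussTerm b a c z (j + 1) + 1 := by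
  rw [Finset.sum_range_succ']
  simp [gaussTerm, poch]

/-- A common multiple of the terms of the series contiguous to `₂F₁(b, a; c; z)`. -/
noncomputable def gaussBase (b a c z : ℂ) (j : ℕ) : ℂ :=
  poch b j * poch a j / (poch c (j + 2) * ((j + 2).factorial : ℂ)) * z ^ (j + 2)

theorem poch_ne_zero {c : ℂ} (hc : ∀ k : ℕ, c + k ≠ 0) (j : ℕ) : poch c j ≠ 0 :=
  Finset.prod_ne_zero_iff.2 fun i _ => hc i

theorem gaussTerm_add_two (b a c z : ℂ) (j : ℕ) :
    gaussTerm b a c z (j + 2) =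
      (b + j) * (b + j + 1) * (a + j) * (a + j + 1) * gaussBase b a c z j := by
  simp only [gaussTerm, gaussBase, poch_succ b, poch_succ a]
  push_cast
  ring

theorem mul_gaussTerm_add_one (b a z : ℂ) {c : ℂ} (hc : ∀ k : ℕ, c + k ≠ 0) (j : ℕ) :
    z * gaussTerm b a c z (j + 1) =
      (b + j) * (a + j) * (c + j + 1) * (j + 2) * gaussBase b a c z j := by
  have h1 := hc (j + 1)
  have h2 := poch_ne_zero hc (j + 1)
  have h3 : (j : ℂ) + 2 ≠ 0 := by exact_mod_cast (Nat.succ_ne_zero (j + 1))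
  have h4 : ((j + 1).factorial : ℂ) ≠ 0 := by exact_mod_cast Nat.factorial_ne_zero _
  simp only [gaussTerm, gaussBase, poch_succ b, poch_succ a, poch_succ c (j + 1),
    Nat.factorial_succ (j + 1)]
  push_cast at h1 ⊢
  rw [← add_assoc] at h1 ⊢
  rw [show (j : ℂ) + 1 + 1 = j + 2 by ring]
  field_simp
  ring

theorem sq_mul_gaussTerm (b a z : ℂ) {c : ℂ} (hc : ∀ k : ℕ, c + k ≠ 0) (j : ℕ) :
    z ^ 2 * gaussTerm b a c z j =
      (c + j) * (c + j + 1) * (j + 1) * (j + 2) * gaussBase b a c z j := by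
  have h0 := hc j
  have h1 := hc (j + 1)
  have h2 := poch_ne_zero hc j
  have h3 : (j : ℂ) + 2 ≠ 0 := by exact_mod_cast (Nat.succ_ne_zero (j + 1))
  have h5 : (j : ℂ) + 1 ≠ 0 := by exact_mod_cast (Nat.succ_ne_zero j)
  have h4 : (j.factorial : ℂ) ≠ 0 := by exact_mod_cast Nat.factorial_ne_zero _
  simp only [gaussTerm, gaussBase, poch_succ c, Nat.factorial_succ]
  push_cast at h1 ⊢
  rw [← add_assoc] at h1 ⊢
  rw [show (j : ℂ) + 1 + 1 = j + 2 by ring]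
  field_simp
  ring

theorem mul_gaussTerm_add_one_left (b a c z : ℂ) (j : ℕ) :
    b * gaussTerm (b + 1) a c z j = (b + j) * gaussTerm b a c z j := by
  have h := (poch_succ_left b j).symm.trans (poch_succ b j)
  simp only [gaussTerm]
  linear_combination (poch a j / (poch c j * (j.factorial : ℂ)) * z ^ j) * h

theorem gaussTerm_shift (b a z : ℂ) {c : ℂ} (hc : ∀ k : ℕ, c + k ≠ 0) (j : ℕ) :
    b * (b + 1) * (a * (a + 1)) / (c * (c + 1) * (c + 2) * (c + 3)) *
        (z ^ 4 * gaussTerm (b + 2) (a + 2) (c + 4) z j) =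
      (j + 4) * (j + 3) * (j + 2) * (j + 1) * gaussBase b a c z (j + 2) := by
  have e2 : ∀ α : ℂ, poch α (j + 2) = α * (α + 1) * poch (α + 2) j := fun α => by
    rw [poch_succ_left, poch_succ_left, show α + 1 + 1 = α + 2 by ring]
    ring
  have e4 : poch c (j + 2 + 2) = c * (c + 1) * (c + 2) * (c + 3) * poch (c + 4) j := by
    rw [poch_succ_left, poch_succ_left, poch_succ_left, poch_succ_left,
      show c + 1 + 1 + 1 + 1 = c + 4 by ring]
    ring
  have k0 : c ≠ 0 := by simpa using hc 0
  have k1 : c + 1 ≠ 0 := by simpa using hc 1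
  have k2 : c + 2 ≠ 0 := by simpa using hc 2
  have k3 : c + 3 ≠ 0 := by simpa using hc 3
  have kp : poch (c + 4) j ≠ 0 :=
    poch_ne_zero (c := c + 4) (fun k => by simpa [add_assoc] using hc (4 + k)) j
  have f1 : (j : ℂ) + 1 ≠ 0 := by exact_mod_cast (Nat.succ_ne_zero j)
  have f2 : (j : ℂ) + 2 ≠ 0 := by exact_mod_cast (Nat.succ_ne_zero (j + 1))
  have f3 : (j : ℂ) + 3 ≠ 0 := by exact_mod_cast (Nat.succ_ne_zero (j + 2))
  have f4 : (j : ℂ) + 4 ≠ 0 := by exact_mod_cast (Nat.succ_ne_zero (j + 3))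
  have hf : (j.factorial : ℂ) ≠ 0 := by exact_mod_cast Nat.factorial_ne_zero _
  have ef : ((j + 2 + 2).factorial : ℂ) = (j + 4) * (j + 3) * (j + 2) * (j + 1) * j.factorial := by
    simp only [Nat.factorial_succ]
    push_cast
    ring
  simp only [gaussTerm, gaussBase, e2, e4, ef]
  field_simp
  ring

/-- The contiguous relation between `₂F₁(2-n, a+2; c+4; z)`, `₂F₁(1-n, a; c; z)` and
`₂F₁(-n, a; c; z)`, for `n = m + 2`, `a = l + y` and `c = 2l`. -/
theorem gaussPoly_contiguous {l : ℂ} (hc : ∀ k : ℕ, 2 * l + k ≠ 0) (y z : ℂ) (m : ℕ) :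
    (l - y) * (l - y + 1) * (2 * l + (m + 2)) * (2 * l + (m + 3)) *
        ((m + 2) * (m + 1) * ((l + y) * (l + y + 1)) /
            (2 * l * (2 * l + 1) * (2 * l + 2) * (2 * l + 3)) *
          (z ^ 4 * gaussPoly m (l + y + 2) (2 * l + 4) z)) =
      2 * (2 * l + 1) * (1 - z) * (-(l + (m + 2)) * z * y + l * (l + 1) * (2 - z)) *
          ((m + 2) * gaussPoly (m + 1) (l + y) (2 * l) z) -
        2 * (m + 2) *
          (l * (l + 1) * ((4 * l + m + 3) * (1 - z) - (m + 1) * ((1 - z) ^ 2 + 1) / 2) +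
            2 * (m + 1) * (-(l + 1 / 2) * (1 - (1 - z) ^ 2) / 2 * y - y ^ 2 * z ^ 2 / 4)) *
          gaussPoly (m + 2) (l + y) (2 * l) z := by
  set a := l + y with ha
  set b : ℂ := -((m + 2 : ℕ) : ℂ) with hb
  have hb' : b = -((m : ℂ) + 2) := by rw [hb]; push_cast; ring
  have hl : l ≠ 0 := by simpa using hc 0
  set v := gaussBase b a (2 * l) z with hv
  have F0 : gaussPoly (m + 2) a (2 * l) z =
      ∑ j ∈ Finset.range (m + 3), (b + j) * (b + j + 1) * (a + j) * (a + j + 1) * v j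
        + b * a / (2 * l) * z + 1 := by
    rw [gaussPoly_eq_sum_range (N := m + 3 + 2) (by omega), sum_range_add_two_gaussTerm]
    simp only [gaussTerm_add_two, hv, hb]
  have F1 : z * gaussPoly (m + 2) a (2 * l) z =
      ∑ j ∈ Finset.range (m + 3), (b + j) * (a + j) * (2 * l + j + 1) * (j + 2) * v j + z := by
    rw [gaussPoly_eq_sum_range (N := m + 3 + 1) (by omega), sum_range_add_one_gaussTerm,
      mul_add, Finset.mul_sum]
    simp only [mul_gaussTerm_add_one _ _ _ hc, hv, hb, mul_one]
  have F2 : z ^ 2 * gaussPoly (m + 2) a (2 * l) z =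
      ∑ j ∈ Finset.range (m + 3),
        (2 * l + j) * (2 * l + j + 1) * (j + 1) * (j + 2) * v j := by
    rw [gaussPoly_eq_sum_range (N := m + 3) (by omega), Finset.mul_sum]
    simp only [sq_mul_gaussTerm _ _ _ hc, hv, hb]
  have hb1 : -((m + 1 : ℕ) : ℂ) = b + 1 := by rw [hb]; push_cast; ring
  have hsucc : ∀ N, m + 2 ≤ N → b * gaussPoly (m + 1) a (2 * l) z =
      ∑ j ∈ Finset.range N, (b + j) * gaussTerm b a (2 * l) z j := fun N hN => by
    rw [gaussPoly_eq_sum_range (N := N) (by omega), Finset.mul_sum, hb1]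
    simp only [mul_gaussTerm_add_one_left]
  have G0 : b * gaussPoly (m + 1) a (2 * l) z =
      ∑ j ∈ Finset.range (m + 3),
          (b + j + 2) * ((b + j) * (b + j + 1) * (a + j) * (a + j + 1)) * v j
        + (b + 1) * (b * a / (2 * l) * z) + b := by
    rw [hsucc (m + 3 + 2) (by omega), Finset.sum_range_succ', Finset.sum_range_succ']
    simp only [gaussTerm_add_two, ← hv]
    congr 1
    · congr 1
      · refine Finset.sum_congr rfl fun j _ => ?_
        push_cast
        ring
      · simp [gaussTerm, poch]
    · simp [gaussTerm, poch]
  have G1 : z * (b * gaussPoly (m + 1) a (2 * l) z) =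
      ∑ j ∈ Finset.range (m + 3),
          (b + j + 1) * ((b + j) * (a + j) * (2 * l + j + 1) * (j + 2)) * v j + b * z := by
    rw [hsucc (m + 3 + 1) (by omega), Finset.sum_range_succ', mul_add, Finset.mul_sum]
    congr 1
    · refine Finset.sum_congr rfl fun j _ => ?_
      have := mul_gaussTerm_add_one b a z hc j
      rw [← hv] at this
      push_cast
      linear_combination (b + j + 1) * this
    · simp [gaussTerm, poch, mul_comm]
  have G2 : z ^ 2 * (b * gaussPoly (m + 1) a (2 * l) z) =
      ∑ j ∈ Finset.range (m + 3),
        (b + j) * ((2 * l + j) * (2 * l + j + 1) * (j + 1) * (j + 2)) * v j := by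
    rw [hsucc (m + 3) (by omega), Finset.mul_sum]
    refine Finset.sum_congr rfl fun j _ => ?_
    have := sq_mul_gaussTerm b a z hc j
    rw [← hv] at this
    linear_combination (b + j) * this
  have H : (m + 2) * (m + 1) * (a * (a + 1)) / (2 * l * (2 * l + 1) * (2 * l + 2) * (2 * l + 3)) *
        (z ^ 4 * gaussPoly m (a + 2) (2 * l + 4) z) =
      ∑ j ∈ Finset.range (m + 3), ((j + 2) * (j + 1) * j * (j - 1) : ℂ) * v j := by
    rw [gaussPoly, Finset.mul_sum, Finset.mul_sum,
      Finset.sum_range_succ' _ (m + 2),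
      Finset.sum_range_succ' _ (m + 1)]
    have hb2 : -(m : ℂ) = b + 2 := by rw [hb']; ring
    have hbb : ((m : ℂ) + 2) * (m + 1) = b * (b + 1) := by rw [hb']; ring
    simp only [hb2, hbb, gaussTerm_shift _ _ _ hc, ← hv]
    simp only [Nat.cast_zero, Nat.cast_add, Nat.cast_one, zero_add, sub_self, mul_zero, zero_mul,
      add_zero]
    refine Finset.sum_congr rfl fun j _ => ?_
    ring
  have hm : (m : ℂ) = -b - 2 := by rw [hb']; ring
  have hy : y = a - l := by rw [ha]; ring
  obtain ⟨t, ht⟩ : ∃ t, t = b * a / (2 * l) := ⟨_, rfl⟩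
  have htl : 2 * l * t = b * a := by rw [ht]; field_simp
  rw [← ht] at F0 G0
  rw [H, hm, hy]
  clear_value b v a
  have hsum : (l - (a - l)) * (l - (a - l) + 1) * (2 * l - b) * (2 * l - b + 1) *
        ∑ j ∈ Finset.range (m + 3), ((j + 2) * (j + 1) * j * (j - 1) : ℂ) * v j =
      (-2 * (2 * l + 1) * (2 * (l * (l + 1)))) *
        ∑ j ∈ Finset.range (m + 3), (b + j + 2) * ((b + j) * (b + j + 1) * (a + j) * (a + j + 1)) * v j +
      (2 * (2 * l + 1) * (3 * (l * (l + 1)) + (l - b) * (a - l))) *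
        ∑ j ∈ Finset.range (m + 3), (b + j + 1) * ((b + j) * (a + j) * (2 * l + j + 1) * (j + 2)) * v j +
      (-2 * (2 * l + 1) * (l * (l + 1) + (l - b) * (a - l))) *
        ∑ j ∈ Finset.range (m + 3), (b + j) * ((2 * l + j) * (2 * l + j + 1) * (j + 1) * (j + 2)) * v j +
      (2 * b * (l * (l + 1)) * (4 * l + 2)) *
        ∑ j ∈ Finset.range (m + 3), (b + j) * (b + j + 1) * (a + j) * (a + j + 1) * v j +
      (2 * b * (-(l * (l + 1)) * (4 * l + 2) + (b + 1) * (2 * l + 1) * (a - l))) *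
        ∑ j ∈ Finset.range (m + 3), (b + j) * (a + j) * (2 * l + j + 1) * (j + 2) * v j +
      (b * (b + 1) * (l * (l + 1) - (2 * l + 1) * (a - l) + (a - l) ^ 2)) *
        ∑ j ∈ Finset.range (m + 3), (2 * l + j) * (2 * l + j + 1) * (j + 1) * (j + 2) * v j := by
    simp only [Finset.mul_sum, ← Finset.sum_add_distrib]
    refine Finset.sum_congr rfl fun j _ => ?_
    ring
  linear_combination hsum -
    (-2 * (2 * l + 1) * (2 * (l * (l + 1)))) * G0 -
    (2 * (2 * l + 1) * (3 * (l * (l + 1)) + (l - b) * (a - l))) * G1 -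
    (-2 * (2 * l + 1) * (l * (l + 1) + (l - b) * (a - l))) * G2 -
    (2 * b * (l * (l + 1)) * (4 * l + 2)) * F0 -
    (2 * b * (-(l * (l + 1)) * (4 * l + 2) + (b + 1) * (2 * l + 1) * (a - l))) * F1 -
    (b * (b + 1) * (l * (l + 1) - (2 * l + 1) * (a - l) + (a - l) ^ 2)) * F2 +
    2 * (2 * l + 1) * (l + 1) * z * htl

theorem meixnerPollaczek_eq_gaussPoly (lam phi : ℝ) (n : ℕ) (x : ℂ) {z : ℂ}
    (hz : z = 1 - Complex.exp (-(2 * Complex.I * phi))) :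
    meixnerPollaczek lam phi n x =
      (Complex.I / z) ^ n * poch (2 * (lam : ℂ)) n *
        gaussPoly n (lam + Complex.I * x) (2 * lam) z := by
  have hE := Complex.exp_ne_zero (2 * Complex.I * phi)
  have h : Complex.exp (2 * Complex.I * phi) / (Complex.exp (2 * Complex.I * phi) - 1) = z⁻¹ := by
    rw [hz, Complex.exp_neg, ← inv_div, sub_div, div_self hE, one_div]
  rw [meixnerPollaczek, h, ← hz, gaussPoly, div_pow, inv_pow]
  simp only [gaussTerm]
  ring

/-- **Mixed recurrence (3.7):** for `λ > 0`, `0 < φ < π`, `n ≥ 2`,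
`[2(n−1)sin²φ/((2λ+1)(2λ+n−1)(λ+n))]·(λ²+x²)((λ+1)²+x²)·P_{n−2}^{(λ+2)}(x;φ)
  = (x + λ(λ+1)cos φ/((λ+n)sin φ))·P_{n−1}^{(λ)}(x;φ) − D(x)·P_n^{(λ)}(x;φ)` where
`D(x) = λ(λ+1)(4λ−(n−1)cos 2φ+n+1)/((2λ+1)(2λ+n−1)(λ+n))
  + 2(n−1)((λ+1/2)sin 2φ − x sin²φ)x/((2λ+1)(2λ+n−1)(λ+n))`. -/
theorem meixnerPollaczek_mixed_recurrence_shift_two (lam : ℝ) (hlam : 0 < lam)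
    (phi : ℝ) (hphi1 : 0 < phi) (hphi2 : phi < Real.pi)
    (n : ℕ) (hn : 2 ≤ n) (x : ℂ) :
    2 * ((n : ℂ) - 1) * (Real.sin phi : ℂ) ^ 2 /
          ((2 * (lam : ℂ) + 1) * (2 * (lam : ℂ) + (n : ℂ) - 1) * ((lam : ℂ) + (n : ℂ))) *
        (((lam : ℂ) ^ 2 + x ^ 2) * (((lam : ℂ) + 1) ^ 2 + x ^ 2)) *
        meixnerPollaczek (lam + 2) phi (n - 2) x =
      (x + (lam : ℂ) * ((lam : ℂ) + 1) * (Real.cos phi : ℂ) /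
            (((lam : ℂ) + (n : ℂ)) * (Real.sin phi : ℂ))) *
          meixnerPollaczek lam phi (n - 1) x -
        ((lam : ℂ) * ((lam : ℂ) + 1) *
              (4 * (lam : ℂ) - ((n : ℂ) - 1) * (Real.cos (2 * phi) : ℂ) + (n : ℂ) + 1) /
              ((2 * (lam : ℂ) + 1) * (2 * (lam : ℂ) + (n : ℂ) - 1) * ((lam : ℂ) + (n : ℂ))) +
            2 * ((n : ℂ) - 1) *
                (((lam : ℂ) + 1 / 2) * (Real.sin (2 * phi) : ℂ) -
                  x * (Real.sin phi : ℂ) ^ 2) * x /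
              ((2 * (lam : ℂ) + 1) * (2 * (lam : ℂ) + (n : ℂ) - 1) * ((lam : ℂ) + (n : ℂ)))) *
          meixnerPollaczek lam phi n x := by
  obtain ⟨m, rfl⟩ : ∃ m, n = m + 2 := ⟨n - 2, by omega⟩
  have hsin : (Real.sin phi : ℂ) ≠ 0 :=
    Complex.ofReal_ne_zero.2 (Real.sin_pos_of_pos_of_lt_pi hphi1 hphi2).ne'
  have hc : ∀ k : ℕ, 2 * (lam : ℂ) + k ≠ 0 := fun k => by
    have : 2 * lam + k ≠ 0 := by positivity
    exact_mod_cast this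
  have hln : (lam : ℂ) + (m + 2) ≠ 0 := by
    have : lam + (m + 2) ≠ 0 := by positivity
    exact_mod_cast this
  obtain ⟨w, hw⟩ : ∃ w, w = Complex.exp (-(2 * Complex.I * phi)) := ⟨_, rfl⟩
  obtain ⟨z, hz⟩ : ∃ z, z = 1 - Complex.exp (-(2 * Complex.I * phi)) := ⟨_, rfl⟩
  obtain ⟨e, he⟩ : ∃ e, e = Complex.exp (phi * Complex.I) := ⟨_, rfl⟩
  have he0 : e ≠ 0 := he ▸ Complex.exp_ne_zero _
  have hI := Complex.I_sq
  have hwe : w = (e ^ 2)⁻¹ := by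
    rw [hw, he, ← Complex.exp_nat_mul, ← Complex.exp_neg]
    congr 1
    push_cast
    ring
  have hzw : z = 1 - w := by rw [hz, hw]
  have hw0 : w ≠ 0 := hw ▸ Complex.exp_ne_zero _
  have hs : (Real.sin phi : ℂ) = (e⁻¹ - e) * Complex.I / 2 := by
    rw [Complex.ofReal_sin, Complex.sin, neg_mul, Complex.exp_neg, he]
  have hcos : (Real.cos phi : ℂ) = (e + e⁻¹) / 2 := by
    rw [Complex.ofReal_cos, Complex.cos, neg_mul, Complex.exp_neg, he]
  have hsz : (Real.sin phi : ℂ) = - e * z * Complex.I / 2 := by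
    rw [hs, hzw, hwe]
    field_simp
    ring
  have hz0 : z ≠ 0 := by
    rintro rfl
    simp [hsz] at hsin
  have hsin_sq : (Real.sin phi : ℂ) ^ 2 = -z ^ 2 / (4 * w) := by
    rw [hsz, hwe]
    field_simp
    rw [hI]
    ring
  have hcot : (Real.cos phi : ℂ) = Real.sin phi * (Complex.I * (2 - z) / z) := by
    rw [hcos, hsz]
    field_simp
    rw [hI, hzw, hwe]
    field_simp
    ring
  have hcos_two : (Real.cos (2 * phi) : ℂ) = (w ^ 2 + 1) / (2 * w) := by
    rw [Real.cos_two_mul, Complex.ofReal_sub, Complex.ofReal_mul, Complex.ofReal_pow, hcos, hwe]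
    push_cast
    field_simp
    ring
  have hsin_two : (Real.sin (2 * phi) : ℂ) = -Complex.I * (1 - w ^ 2) / (2 * w) := by
    rw [Real.sin_two_mul, Complex.ofReal_mul, Complex.ofReal_mul, hs, hcos, hwe]
    push_cast
    field_simp
    ring
  have hcore := gaussPoly_contiguous hc (Complex.I * x) z m
  have hp : poch (2 * (lam : ℂ)) (m + 2) = poch (2 * (lam : ℂ)) (m + 1) * (2 * lam + (m + 1)) := by
    rw [poch_succ]
    push_cast
    ring
  have hk (k : ℕ) (r : ℂ) (hr : r = 2 * lam + k) : r ≠ 0 := hr ▸ hc k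
  have k0 : (lam : ℂ) ≠ 0 := Complex.ofReal_ne_zero.2 hlam.ne'
  have k1 := hk 1 (2 * lam + 1) (by simp)
  have k2 := hk 2 (2 * lam + 2) (by simp)
  have k3 := hk 3 (2 * lam + 3) (by simp)
  have km := hk (m + 1) (2 * lam + (m + 1)) (by simp)
  have hp4 : poch (2 * ((lam + 2 : ℝ) : ℂ)) m =
      poch (2 * (lam : ℂ)) (m + 1) * (2 * lam + (m + 1)) * (2 * lam + (m + 2)) *
        (2 * lam + (m + 3)) / (2 * lam * (2 * lam + 1) * (2 * lam + 2) * (2 * lam + 3)) := by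
    have hl : poch (2 * (lam : ℂ)) (m + 4) =
        2 * lam * (2 * lam + 1) * (2 * lam + 2) * (2 * lam + 3) * poch (2 * (lam : ℂ) + 4) m := by
      rw [poch_succ_left, poch_succ_left, poch_succ_left, poch_succ_left,
        show 2 * (lam : ℂ) + 1 + 1 + 1 + 1 = 2 * lam + 4 by ring]
      ring
    have hr : poch (2 * (lam : ℂ)) (m + 4) =
        poch (2 * (lam : ℂ)) (m + 1) * (2 * lam + (m + 1)) * (2 * lam + (m + 2)) *
          (2 * lam + (m + 3)) := by
      rw [poch_succ, poch_succ, hp]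
      push_cast
      ring
    rw [← hr, hl, eq_div_iff (by simp [*]),
      show 2 * ((lam + 2 : ℝ) : ℂ) = 2 * lam + 4 by push_cast; ring]
    ring
  have hm : (m : ℂ) + 2 ≠ 0 := by exact_mod_cast Nat.succ_ne_zero (m + 1)
  rw [show m + 2 - 2 = m by omega, show m + 2 - 1 = m + 1 by omega,
    meixnerPollaczek_eq_gaussPoly _ _ _ _ hz, meixnerPollaczek_eq_gaussPoly _ _ _ _ hz,
    meixnerPollaczek_eq_gaussPoly _ _ _ _ hz, hp, hp4,
    show (((lam + 2 : ℝ) : ℂ)) + Complex.I * x = lam + Complex.I * x + 2 by push_cast; ring,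
    show 2 * ((lam + 2 : ℝ) : ℂ) = 2 * lam + 4 by push_cast; ring, hcot, hsin_sq, hcos_two,
    hsin_two]
  generalize gaussPoly m _ _ _ = G at *
  generalize gaussPoly (m + 1) _ _ _ = F' at *
  generalize gaussPoly (m + 2) _ _ _ = F at *
  generalize poch (2 * (lam : ℂ)) (m + 1) = p at *
  generalize (Real.sin phi : ℂ) = s at *
  generalize (lam : ℂ) = l at *
  have hw1 : w = 1 - z := by rw [hzw]; ring
  have hq1 : (Complex.I / z) ^ (m + 1) = (Complex.I / z) ^ m * (Complex.I / z) := pow_succ _ _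
  have hq2 : (Complex.I / z) ^ (m + 2) = (Complex.I / z) ^ m * (-1 / z ^ 2) := by
    rw [pow_add, div_pow Complex.I z 2, hI]
  rw [hq1, hq2]
  generalize (Complex.I / z) ^ m = q at *
  rw [hw1] at hw0 ⊢
  push_cast
  rw [show 2 * l + ((m : ℂ) + 2) - 1 = 2 * l + (m + 1) by ring]
  obtain ⟨y, hy⟩ : ∃ y, y = Complex.I * x := ⟨_, rfl⟩
  have hxy : x = -Complex.I * y := by rw [hy]; linear_combination x * hI
  rw [← hy] at hcore
  rw [hxy]
  rw [← sub_eq_zero] at hcore ⊢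
  refine Eq.trans ?_ ((congrArg (fun t => -(q * p) /
    ((1 - z) * z ^ 2 * (2 * (m + 2) * (2 * l + 1) * (l + (m + 2)))) * t) hcore).trans (mul_zero _))
  field_simp
  ring_nf
  simp only [hI, Complex.I_pow_four]
  ring
end
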